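/- arXiv:cs/0512028 — 3 statements merged into one kernel-verified Lean document; each statement's English description precedes it below -/
import Mathlib

section
/- Let X and Y be independent random variables, each exponentially distributed with rate 1 (i.e., P(X > t) = e^{−t} for all t ≥ 0). Then for every z with 0 < z ≤ 1, P(X·Y ≤ z) ≤ z·(2 − log z). -/
open MeasureTheory ProbabilityTheory

/-- A law on `ℝ` whose distribution function is at most `s` at every `s > 0` is carried by the
positive reals. -/
lemma ae_pos_of_measure_Iic_le {P : Measure ℝ}
    (hP : ∀ s : ℝ, 0 < s → P (Set.Iic s) ≤ ENNReal.ofReal s) : ∀ᵐ x ∂P, 0 < x := by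
  have h0 : P (Set.Iic 0) = 0 := by
    refine le_antisymm (ENNReal.le_of_forall_pos_le_add fun ε hε _ => ?_) zero_le
    calc P (Set.Iic 0) ≤ P (Set.Iic (ε : ℝ)) :=
          measure_mono (Set.Iic_subset_Iic.2 ε.coe_nonneg)
      _ ≤ ENNReal.ofReal ε := hP _ (by exact_mod_cast hε)
      _ = 0 + ε := by simp
  rw [ae_iff]
  convert h0 using 2
  ext x
  simp

lemma setLIntegral_Ioc_ofReal_div {z : ℝ} (hz : 0 < z) (hz1 : z ≤ 1) :
    ∫⁻ t in Set.Ioc z 1, ENNReal.ofReal (z / t) = ENNReal.ofReal (-(z * Real.log z)) := by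
  have hint : IntervalIntegrable (fun t : ℝ => z / t) volume z 1 := by
    refine ContinuousOn.intervalIntegrable fun t ht => ?_
    rw [Set.uIcc_of_le hz1] at ht
    exact (continuousAt_const.div continuousAt_id (hz.trans_le ht.1).ne').continuousWithinAt
  rw [← ofReal_integral_eq_lintegral_ofReal
    ((intervalIntegrable_iff_integrableOn_Ioc_of_le hz1).1 hint),
    ← intervalIntegral.integral_of_le hz1]
  · simp only [div_eq_mul_inv, intervalIntegral.integral_const_mul]
    rw [integral_inv_of_pos hz one_pos, one_div, Real.log_inv, mul_neg]
  · filter_upwards [ae_restrict_mem measurableSet_Ioc] with t ht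
    exact div_nonneg hz.le (hz.trans ht.1).le

/-- If the distribution function of `P` is at most `s` at every `s > 0`, the mean of
`min 1 (z / x)` under `P` is at most its value for the uniform law on `[0, 1]`. -/
lemma lintegral_min_one_div_le {P : Measure ℝ} [IsProbabilityMeasure P]
    (hP : ∀ s : ℝ, 0 < s → P (Set.Iic s) ≤ ENNReal.ofReal s)
    {z : ℝ} (hz : 0 < z) (hz1 : z ≤ 1) :
    ∫⁻ x, ENNReal.ofReal (min 1 (z / x)) ∂P ≤ ENNReal.ofReal (z * (1 - Real.log z)) := by
  have hpos := ae_pos_of_measure_Iic_le hP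
  have hnn : 0 ≤ᵐ[P] fun x => min 1 (z / x) := by
    filter_upwards [hpos] with x hx
    exact le_min zero_le_one (div_pos hz hx).le
  rw [lintegral_eq_lintegral_meas_le P hnn (by fun_prop)]
  have hsplit : Set.Ioi (0 : ℝ) = Set.Ioc 0 z ∪ (Set.Ioc z 1 ∪ Set.Ioi 1) := by
    rw [Set.Ioc_union_Ioi_eq_Ioi hz1, Set.Ioc_union_Ioi_eq_Ioi hz.le]
  have hsmall : ∫⁻ t in Set.Ioc 0 z, P {x | t ≤ min 1 (z / x)} ≤ ENNReal.ofReal z := by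
    calc ∫⁻ t in Set.Ioc 0 z, P {x | t ≤ min 1 (z / x)}
        ≤ ∫⁻ _ in Set.Ioc 0 z, 1 := lintegral_mono fun _ => prob_le_one
      _ = ENNReal.ofReal z := by simp
  have hmid : ∫⁻ t in Set.Ioc z 1, P {x | t ≤ min 1 (z / x)} ≤
      ENNReal.ofReal (-(z * Real.log z)) := by
    rw [← setLIntegral_Ioc_ofReal_div hz hz1]
    refine setLIntegral_mono' measurableSet_Ioc fun t ht => ?_
    have ht0 : 0 < t := hz.trans ht.1
    refine (measure_mono_ae ?_).trans (hP (z / t) (div_pos hz ht0))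
    filter_upwards [hpos] with x hx hxt
    exact (le_div_comm₀ ht0 hx).1 (hxt.trans (min_le_right _ _))
  have hlarge : ∫⁻ t in Set.Ioi 1, P {x | t ≤ min 1 (z / x)} = 0 := by
    rw [setLIntegral_congr_fun (g := fun _ => 0) measurableSet_Ioi, lintegral_zero]
    intro t ht
    have : {x : ℝ | t ≤ min 1 (z / x)} = ∅ :=
      Set.eq_empty_of_forall_notMem fun x hx =>
        (not_le.2 (Set.mem_Ioi.1 ht)) (le_trans hx (min_le_left _ _))
    simp only [this, measure_empty]
  have hlog : 0 ≤ -(z * Real.log z) := by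
    have := mul_nonpos_of_nonneg_of_nonpos hz.le (Real.log_nonpos hz.le hz1)
    linarith
  rw [hsplit]
  refine (lintegral_union_le _ _ _).trans ?_
  refine (add_le_add hsmall ((lintegral_union_le _ _ _).trans
    (add_le_add hmid hlarge.le))).trans ?_
  rw [add_zero, ← ENNReal.ofReal_add hz.le hlog]
  exact ENNReal.ofReal_le_ofReal (by linarith)

/-- Lower tail of a product of independent variables that stochastically dominate the uniform
law on `[0, 1]`. -/
lemma measure_prod_mul_le_of_measure_Iic_le {P Q : Measure ℝ} [IsProbabilityMeasure P]
    [IsProbabilityMeasure Q] (hP : ∀ s : ℝ, 0 < s → P (Set.Iic s) ≤ ENNReal.ofReal s)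
    (hQ : ∀ s : ℝ, 0 < s → Q (Set.Iic s) ≤ ENNReal.ofReal s)
    {z : ℝ} (hz : 0 < z) (hz1 : z ≤ 1) :
    P.prod Q {p | p.1 * p.2 ≤ z} ≤ ENNReal.ofReal (z * (1 - Real.log z)) := by
  rw [Measure.prod_apply (measurableSet_le (by fun_prop) (by fun_prop))]
  refine (lintegral_mono_ae ?_).trans (lintegral_min_one_div_le hP hz hz1)
  filter_upwards [ae_pos_of_measure_Iic_le hP] with x hx
  have hpre : Prod.mk x ⁻¹' {p : ℝ × ℝ | p.1 * p.2 ≤ z} = Set.Iic (z / x) := by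
    ext y
    simp [le_div_iff₀' hx]
  rw [hpre, ENNReal.ofReal_min, ENNReal.ofReal_one]
  exact le_min prob_le_one (hQ _ (div_pos hz hx))

lemma map_Iic_le_of_exponential_tail {Ω : Type*} [MeasurableSpace Ω] {μ : Measure Ω}
    [IsProbabilityMeasure μ] {X : Ω → ℝ} (hX : Measurable X)
    (hexp : ∀ t : ℝ, 0 ≤ t → μ {ω | t < X ω} = ENNReal.ofReal (Real.exp (-t)))
    (s : ℝ) (hs : 0 < s) : μ.map X (Set.Iic s) ≤ ENNReal.ofReal s := by
  have hcompl : X ⁻¹' Set.Iic s = {ω | s < X ω}ᶜ := by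
    ext ω
    simp
  rw [Measure.map_apply hX measurableSet_Iic, hcompl,
    prob_compl_eq_one_sub (measurableSet_lt measurable_const hX), hexp s hs.le,
    ← ENNReal.ofReal_one, ← ENNReal.ofReal_sub _ (Real.exp_pos _).le]
  exact ENNReal.ofReal_le_ofReal (by linarith [Real.add_one_le_exp (-s)])

/-- Lower-tail bound for the product of two independent unit-rate exponential random
variables: for every `0 < z ≤ 1`, `P(X·Y ≤ z) ≤ z·(2 − log z)`. -/
theorem cdf_product_of_exponentials_le {Ω : Type*} [MeasurableSpace Ω] (μ : Measure Ω)
    [IsProbabilityMeasure μ] (X Y : Ω → ℝ)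
    (hXmeas : Measurable X) (hYmeas : Measurable Y)
    (hindep : IndepFun X Y μ)
    (hXexp : ∀ t : ℝ, 0 ≤ t → μ {ω | t < X ω} = ENNReal.ofReal (Real.exp (-t)))
    (hYexp : ∀ t : ℝ, 0 ≤ t → μ {ω | t < Y ω} = ENNReal.ofReal (Real.exp (-t))) :
    ∀ z : ℝ, 0 < z → z ≤ 1 →
      (μ {ω | X ω * Y ω ≤ z}).toReal ≤ z * (2 - Real.log z) := by
  intro z hz hz1
  have hlog := Real.log_nonpos hz.le hz1
  have := Measure.isProbabilityMeasure_map (μ := μ) hXmeas.aemeasurable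
  have := Measure.isProbabilityMeasure_map (μ := μ) hYmeas.aemeasurable
  have hle := measure_prod_mul_le_of_measure_Iic_le
    (map_Iic_le_of_exponential_tail hXmeas hXexp)
    (map_Iic_le_of_exponential_tail hYmeas hYexp) hz hz1
  rw [← (indepFun_iff_map_prod_eq_prod_map_map hXmeas.aemeasurable hYmeas.aemeasurable).1 hindep,
    Measure.map_apply (hXmeas.prodMk hYmeas)
      (measurableSet_le (by fun_prop) (by fun_prop))] at hle
  refine (ENNReal.toReal_le_of_le_ofReal (mul_nonneg hz.le (by linarith)) hle).trans ?_
  gcongr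
  norm_num
end

section
/- Let X and Y be independent random variables, each exponentially distributed with rate 1 (i.e., P(X > t) = e^{−t} for all t ≥ 0). Then lim_{z → 0⁺} P(X·Y ≤ z) / (z·(1 − log z)) = 1. -/
open MeasureTheory ProbabilityTheory Filter

lemma map_eq_expMeasure_one_of_tail {Ω : Type*} [MeasurableSpace Ω]
    {μ : Measure Ω} [IsProbabilityMeasure μ] {X : Ω → ℝ} (hX : Measurable X)
    (htail : ∀ t : ℝ, 0 ≤ t → μ {ω | t < X ω} = ENNReal.ofReal (Real.exp (-t))) :
    μ.map X = expMeasure 1 := by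
  have := Measure.isProbabilityMeasure_map (μ := μ) hX.aemeasurable
  have := isProbabilityMeasure_expMeasure (r := 1) one_pos
  have hnonneg : ∀ t : ℝ, 0 ≤ t → cdf (μ.map X) t = 1 - Real.exp (-t) := by
    intro t ht
    have hIoi : (μ.map X).real (Set.Ioi t) = Real.exp (-t) := by
      rw [map_measureReal_apply hX measurableSet_Ioi, measureReal_def]
      change (μ {ω | t < X ω}).toReal = _
      rw [htail t ht, ENNReal.toReal_ofReal (Real.exp_pos _).le]
    rw [cdf_eq_real, ← hIoi, ← Set.compl_Ioi, probReal_compl_eq_one_sub measurableSet_Ioi]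
  apply Measure.eq_of_cdf
  ext t
  rw [cdf_expMeasure_eq one_pos]
  split_ifs with ht
  · rw [hnonneg t ht, one_mul]
  · refine le_antisymm ?_ (cdf_nonneg _ _)
    have h := monotone_cdf (μ.map X) (not_le.mp ht).le
    simpa [hnonneg 0 le_rfl] using h

lemma integral_expMeasure_one (g : ℝ → ℝ) :
    ∫ x, g x ∂(expMeasure 1) = ∫ x in Set.Ioi 0, Real.exp (-x) * g x := by
  have hm : Measurable (gammaPDF 1 1) := (measurable_gammaPDFReal 1 1).ennreal_ofReal
  rw [expMeasure, gammaMeasure, integral_withDensity_eq_integral_toReal_smul hm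
    (ae_of_all _ fun _ => ENNReal.ofReal_lt_top), ← integral_Ici_eq_integral_Ioi,
    ← setIntegral_eq_integral_of_forall_compl_eq_zero (s := Set.Ici (0 : ℝ))]
  · refine setIntegral_congr_fun measurableSet_Ici fun x hx => ?_
    have h : gammaPDF 1 1 x = ENNReal.ofReal (Real.exp (-x)) := by
      rw [show gammaPDF 1 1 x = exponentialPDF 1 x from rfl, exponentialPDF_of_nonneg hx,
        one_mul, one_mul]
    simp only [h, ENNReal.toReal_ofReal (Real.exp_pos _).le, smul_eq_mul]
  · intro x hx
    simp [gammaPDF_of_neg (not_le.mp hx)]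

lemma measureReal_mul_le_of_indep_exp {Ω : Type*} [MeasurableSpace Ω]
    {μ : Measure Ω} [IsProbabilityMeasure μ] {X Y : Ω → ℝ}
    (hX : Measurable X) (hY : Measurable Y) (hindep : IndepFun X Y μ)
    (hXlaw : μ.map X = expMeasure 1) (hYlaw : μ.map Y = expMeasure 1)
    {z : ℝ} (hz : 0 ≤ z) :
    (μ {ω | X ω * Y ω ≤ z}).toReal =
      ∫ x in Set.Ioi 0, Real.exp (-x) * (1 - Real.exp (-(z / x))) := by
  have := isProbabilityMeasure_expMeasure (r := 1) one_pos
  have hs : MeasurableSet {p : ℝ × ℝ | p.1 * p.2 ≤ z} :=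
    measurableSet_le (by fun_prop) measurable_const
  have hprod : μ {ω | X ω * Y ω ≤ z} =
      ((expMeasure 1).prod (expMeasure 1)) {p : ℝ × ℝ | p.1 * p.2 ≤ z} := by
    have h := (indepFun_iff_map_prod_eq_prod_map_map hX.aemeasurable hY.aemeasurable).mp hindep
    rw [hXlaw, hYlaw] at h
    rw [← h, Measure.map_apply (hX.prodMk hY) hs]
    rfl
  rw [hprod, Measure.prod_apply hs,
    ← integral_toReal (measurable_measure_prodMk_left hs).aemeasurable
      (ae_of_all _ fun _ => measure_lt_top _ _), integral_expMeasure_one]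
  refine setIntegral_congr_fun measurableSet_Ioi fun x hx => ?_
  have hx : 0 < x := hx
  have hslice : Prod.mk x ⁻¹' {p : ℝ × ℝ | p.1 * p.2 ≤ z} = Set.Iic (z / x) := by
    ext y
    simp [le_div_iff₀ hx, mul_comm]
  have h := cdf_expMeasure_eq (r := 1) one_pos (z / x)
  rw [cdf_eq_real, if_pos (by positivity), one_mul, measureReal_def] at h
  simp only [hslice, h]

lemma integrableOn_exp_neg_mul_one_sub_exp_neg_div {z : ℝ} (hz : 0 ≤ z) :
    IntegrableOn (fun x => Real.exp (-x) * (1 - Real.exp (-(z / x)))) (Set.Ioi 0) := by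
  refine (integrableOn_exp_neg_Ioi 0).mono' (by fun_prop) ?_
  refine (ae_restrict_iff' measurableSet_Ioi).mpr (ae_of_all _ fun x hx => ?_)
  have hx : 0 < x := hx
  have h1 : Real.exp (-(z / x)) ≤ 1 := Real.exp_le_one_iff.mpr (by simp; positivity)
  rw [Real.norm_of_nonneg (mul_nonneg (Real.exp_pos _).le (by linarith))]
  exact mul_le_of_le_one_right (Real.exp_pos _).le (by linarith [Real.exp_pos (-(z / x))])

lemma integral_exp_neg_mul_one_sub_exp_neg_div_le {z : ℝ} (hz : 0 < z) (hz1 : z < 1) :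
    ∫ x in Set.Ioi 0, Real.exp (-x) * (1 - Real.exp (-(z / x))) ≤ z * (2 - Real.log z) := by
  have hint := integrableOn_exp_neg_mul_one_sub_exp_neg_div hz.le
  set g : ℝ → ℝ := fun x => Real.exp (-x) * (1 - Real.exp (-(z / x)))
  have hint' : ∀ {a : ℝ}, 0 ≤ a → IntegrableOn g (Set.Ioi a) := fun ha =>
    hint.mono_set (Set.Ioi_subset_Ioi ha)
  have hii : ∀ {a b : ℝ}, 0 ≤ a → a ≤ b → IntervalIntegrable g volume a b := fun ha hab =>
    (intervalIntegrable_iff_integrableOn_Ioc_of_le hab).mpr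
      ((hint' ha).mono_set Set.Ioc_subset_Ioi_self)
  have hsplit : ∫ x in Set.Ioi 0, g x =
      (∫ x in (0 : ℝ)..z, g x) + (∫ x in z..1, g x) + ∫ x in Set.Ioi 1, g x := by
    rw [intervalIntegral.integral_add_adjacent_intervals (hii le_rfl hz.le) (hii hz.le hz1.le),
      intervalIntegral.integral_interval_add_Ioi hint (hint' zero_le_one)]
  have hle_one : ∀ x, 0 ≤ x → g x ≤ 1 := fun x hx =>
    mul_le_one₀ (Real.exp_le_one_iff.mpr (by linarith))
      (by
        have : Real.exp (-(z / x)) ≤ 1 := Real.exp_le_one_iff.mpr (by simp; positivity)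
        linarith)
      (by linarith [Real.exp_pos (-(z / x))])
  have hle_div : ∀ x, g x ≤ Real.exp (-x) * (z / x) := fun x =>
    mul_le_mul_of_nonneg_left (by linarith [Real.one_sub_le_exp_neg (z / x)]) (Real.exp_pos _).le
  have hnear : ∫ x in (0 : ℝ)..z, g x ≤ z := by
    calc ∫ x in (0 : ℝ)..z, g x ≤ ∫ x in (0 : ℝ)..z, (1 : ℝ) :=
          intervalIntegral.integral_mono_on hz.le (hii le_rfl hz.le) (by simp)
            fun x hx => hle_one x hx.1
      _ = z := by simp
  have h0 : (0 : ℝ) ∉ Set.uIcc z 1 := by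
    rw [Set.uIcc_of_le hz1.le]
    exact fun h => absurd h.1 (not_le.mpr hz)
  have hmid : ∫ x in z..1, g x ≤ -(z * Real.log z) := by
    calc ∫ x in z..1, g x ≤ ∫ x in z..1, z * x⁻¹ := by
          refine intervalIntegral.integral_mono_on hz1.le (hii hz.le hz1.le)
            ((intervalIntegrable_inv_iff.mpr (Or.inr h0)).const_mul z)
            fun x hx => (hle_div x).trans ?_
          have hx0 : 0 < x := hz.trans_le hx.1
          rw [← div_eq_mul_inv]
          exact mul_le_of_le_one_left (by positivity) (Real.exp_le_one_iff.mpr (by linarith))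
      _ = -(z * Real.log z) := by
          rw [intervalIntegral.integral_const_mul, integral_inv h0, one_div, Real.log_inv]
          ring
  have hfar : ∫ x in Set.Ioi 1, g x ≤ z := by
    calc ∫ x in Set.Ioi 1, g x ≤ ∫ x in Set.Ioi 1, Real.exp (-x) * z := by
          refine setIntegral_mono_on (hint' zero_le_one)
            ((integrableOn_exp_neg_Ioi 1).mul_const z) measurableSet_Ioi fun x hx => ?_
          exact (hle_div x).trans (mul_le_mul_of_nonneg_left
            (div_le_self hz.le (le_of_lt hx)) (Real.exp_pos _).le)
      _ = Real.exp (-1) * z := by rw [integral_mul_const, integral_exp_neg_Ioi]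
      _ ≤ z := mul_le_of_le_one_left hz.le (Real.exp_le_one_iff.mpr (by norm_num))
  rw [hsplit]
  linarith

lemma le_integral_exp_neg_mul_one_sub_exp_neg_div {z : ℝ} (hz : 0 < z) (hz1 : z < 1) :
    z * (-2 - Real.log z) ≤ ∫ x in Set.Ioi 0, Real.exp (-x) * (1 - Real.exp (-(z / x))) := by
  have hint := integrableOn_exp_neg_mul_one_sub_exp_neg_div hz.le
  set g : ℝ → ℝ := fun x => Real.exp (-x) * (1 - Real.exp (-(z / x)))
  have hsub : Set.Ioc z 1 ⊆ Set.Ioi 0 := fun x hx => hz.trans hx.1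
  have hrestrict : ∫ x in z..1, g x ≤ ∫ x in Set.Ioi 0, g x := by
    rw [intervalIntegral.integral_of_le hz1.le]
    refine setIntegral_mono_set hint ?_ hsub.eventuallyLE
    refine (ae_restrict_iff' measurableSet_Ioi).mpr (ae_of_all _ fun x hx => ?_)
    have hx : 0 < x := hx
    have h1 : Real.exp (-(z / x)) ≤ 1 := Real.exp_le_one_iff.mpr (by simp; positivity)
    exact mul_nonneg (Real.exp_pos _).le (by linarith)
  have hcont : ContinuousOn (fun x : ℝ => z / x - z ^ 2 / x ^ 2 - z) (Set.uIcc z 1) := by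
    rw [Set.uIcc_of_le hz1.le]
    have hne : ∀ x ∈ Set.Icc z 1, x ≠ 0 := fun x hx => (hz.trans_le hx.1).ne'
    exact ((continuousOn_const.div continuousOn_id hne).sub
      (continuousOn_const.div (continuousOn_id.pow 2) fun x hx => pow_ne_zero 2 (hne x hx))).sub
      continuousOn_const
  have hFTC : ∫ x in z..1, (z / x - z ^ 2 / x ^ 2 - z) =
      (z * Real.log 1 + z ^ 2 * 1⁻¹ - z * 1) - (z * Real.log z + z ^ 2 * z⁻¹ - z * z) := by
    refine intervalIntegral.integral_eq_sub_of_hasDerivAt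
      (f := fun x => z * Real.log x + z ^ 2 * x⁻¹ - z * x) (fun x hx => ?_)
      hcont.intervalIntegrable
    rw [Set.uIcc_of_le hz1.le] at hx
    have hx0 : x ≠ 0 := (hz.trans_le hx.1).ne'
    convert (((Real.hasDerivAt_log hx0).const_mul z).add
      ((hasDerivAt_inv hx0).const_mul (z ^ 2))).sub ((hasDerivAt_id x).const_mul z) using 1
    · rfl
    · rw [div_eq_mul_inv, div_eq_mul_inv]
      ring
  have hlower : ∫ x in z..1, (z / x - z ^ 2 / x ^ 2 - z) ≤ ∫ x in z..1, g x := by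
    refine intervalIntegral.integral_mono_on hz1.le hcont.intervalIntegrable
      ((intervalIntegrable_iff_integrableOn_Ioc_of_le hz1.le).mpr (hint.mono_set hsub))
      fun x hx => ?_
    have hx0 : 0 < x := hz.trans_le hx.1
    have hu0 : 0 ≤ z / x := by positivity
    have hu1 : z / x ≤ 1 := (div_le_one hx0).mpr hx.1
    have hux : z / x * x = z := div_mul_cancel₀ z hx0.ne'
    have hquad := (abs_le.mp (Real.abs_exp_sub_one_sub_id_le (x := -(z / x))
      (by rwa [abs_neg, abs_of_nonneg hu0]))).2
    have hmul : (1 - x) * (z / x - (z / x) ^ 2) ≤ g x :=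
      mul_le_mul (Real.one_sub_le_exp_neg x) (by linarith [neg_sq (z / x)])
        (by nlinarith) (Real.exp_pos _).le
    have hsq : 0 ≤ x * (z / x) ^ 2 := by positivity
    rw [← div_pow]
    linarith
  have hsimp : z ^ 2 * z⁻¹ = z := by field_simp
  rw [hFTC, hsimp, Real.log_one] at hlower
  nlinarith [sq_nonneg z]

/-- Lower-tail asymptotics for the product of two independent unit-rate exponential
random variables: `P(X·Y ≤ z) / (z·(1 − log z)) → 1` as `z → 0⁺`. -/
theorem cdf_product_of_exponentials_asymptotic {Ω : Type*} [MeasurableSpace Ω]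
    (μ : Measure Ω) [IsProbabilityMeasure μ] (X Y : Ω → ℝ)
    (hXmeas : Measurable X) (hYmeas : Measurable Y)
    (hindep : IndepFun X Y μ)
    (hXexp : ∀ t : ℝ, 0 ≤ t → μ {ω | t < X ω} = ENNReal.ofReal (Real.exp (-t)))
    (hYexp : ∀ t : ℝ, 0 ≤ t → μ {ω | t < Y ω} = ENNReal.ofReal (Real.exp (-t))) :
    Tendsto (fun z : ℝ => (μ {ω | X ω * Y ω ≤ z}).toReal / (z * (1 - Real.log z)))
      (nhdsWithin 0 (Set.Ioi 0)) (nhds 1) := by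
  have hden : Tendsto (fun z : ℝ => 1 - Real.log z) (nhdsWithin 0 (Set.Ioi 0)) atTop := by
    simpa only [sub_eq_add_neg, Function.comp_apply] using tendsto_atTop_add_const_left _ 1
      (tendsto_neg_atBot_atTop.comp Real.tendsto_log_nhdsGT_zero)
  have hlim : ∀ c : ℝ, Tendsto (fun z : ℝ => 1 + c / (1 - Real.log z))
      (nhdsWithin 0 (Set.Ioi 0)) (nhds 1) := fun c => by
    simpa using (hden.const_div_atTop c).const_add 1
  have hbounds : ∀ᶠ z : ℝ in nhdsWithin 0 (Set.Ioi 0),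
      0 < z ∧ 0 < 1 - Real.log z ∧
        z * (-2 - Real.log z) ≤ (μ {ω | X ω * Y ω ≤ z}).toReal ∧
        (μ {ω | X ω * Y ω ≤ z}).toReal ≤ z * (2 - Real.log z) := by
    filter_upwards [Ioo_mem_nhdsGT (zero_lt_one' ℝ)] with z ⟨hz, hz1⟩
    rw [measureReal_mul_le_of_indep_exp hXmeas hYmeas hindep
      (map_eq_expMeasure_one_of_tail hXmeas hXexp)
      (map_eq_expMeasure_one_of_tail hYmeas hYexp) hz.le]
    exact ⟨hz, by linarith [Real.log_neg hz hz1],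
      le_integral_exp_neg_mul_one_sub_exp_neg_div hz hz1,
      integral_exp_neg_mul_one_sub_exp_neg_div_le hz hz1⟩
  refine tendsto_of_tendsto_of_tendsto_of_le_of_le' (hlim (-3)) (hlim 1) ?_ ?_
  · filter_upwards [hbounds] with z ⟨hz, hlog, hlow, _⟩
    rw [le_div_iff₀ (by positivity)]
    refine le_trans (le_of_eq ?_) hlow
    field_simp
    ring
  · filter_upwards [hbounds] with z ⟨hz, hlog, _, hupp⟩
    rw [div_le_iff₀ (by positivity)]
    refine hupp.trans (le_of_eq ?_)
    field_simp
    ring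
end

section
/- For every real number r with 0 < r < 1, the infimum of φ₁ + φ₂ + ξ₂ over all triples (φ₁, φ₂, ξ₂) of nonnegative real numbers satisfying max{ 2·max(1 − φ₁, 0), 1 − φ₂ − ξ₂ } < 2r equals (1 − r) + max(1 − 2r, 0). -/
/-- **Outage-exponent optimization for the dynamic amplify-and-forward relay network.**
For every `0 < r < 1`, the infimum of `φ₁ + φ₂ + ξ₂` over all triples of nonnegative
reals satisfying `max{2·(1 − φ₁)⁺, 1 − φ₂ − ξ₂} < 2r` equals `(1 − r) + (1 − 2r)⁺`. -/
theorem outage_exponent_DAAF (r : ℝ) (hr0 : 0 < r) (hr1 : r < 1) :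
    sInf {s : ℝ | ∃ φ₁ φ₂ ξ₂ : ℝ, 0 ≤ φ₁ ∧ 0 ≤ φ₂ ∧ 0 ≤ ξ₂ ∧
        max (2 * max (1 - φ₁) 0) (1 - φ₂ - ξ₂) < 2 * r ∧ s = φ₁ + φ₂ + ξ₂}
      = (1 - r) + max (1 - 2 * r) 0 := by
  have hle : 1 - 2 * r ≤ max (1 - 2 * r) 0 := le_max_left _ _
  have hnonneg : 0 ≤ max (1 - 2 * r) 0 := le_max_right _ _
  -- Feasible points whose objective exceeds the claimed infimum by exactly `2 * ε`.
  have hmem : ∀ ε : ℝ, 0 < ε → ∃ φ₁ φ₂ ξ₂ : ℝ, 0 ≤ φ₁ ∧ 0 ≤ φ₂ ∧ 0 ≤ ξ₂ ∧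
      max (2 * max (1 - φ₁) 0) (1 - φ₂ - ξ₂) < 2 * r ∧
        (1 - r) + max (1 - 2 * r) 0 + 2 * ε = φ₁ + φ₂ + ξ₂ := by
    intro ε hε
    refine ⟨1 - r + ε, max (1 - 2 * r) 0 + ε, 0, by linarith, by linarith, le_rfl,
      max_lt ?_ (by linarith), by ring⟩
    have : max (1 - (1 - r + ε)) 0 < r := max_lt (by linarith) hr0
    linarith
  refine csInf_eq_of_forall_ge_of_forall_gt_exists_lt ⟨_, hmem 1 one_pos⟩ ?_ ?_
  · rintro s ⟨φ₁, φ₂, ξ₂, -, h₂, h₃, h, rfl⟩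
    obtain ⟨ha, hb⟩ := max_lt_iff.mp h
    have h₁ : 1 - φ₁ ≤ max (1 - φ₁) 0 := le_max_left _ _
    have h₂₃ : max (1 - 2 * r) 0 ≤ φ₂ + ξ₂ := max_le (by linarith) (by linarith)
    linarith
  · intro w hw
    exact ⟨_, hmem ((w - ((1 - r) + max (1 - 2 * r) 0)) / 3) (by linarith), by linarith⟩
end
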